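/- Let v, w ∈ ℤ³ be integer vectors whose images in ℝ³ are linearly independent over ℝ, and let v̂ = v/‖v‖ and ŵ = w/‖w‖ be the corresponding unit vectors in ℝ³. Then min(‖v̂ − ŵ‖, ‖v̂ + ŵ‖) ≥ 1/(‖v‖·‖w‖). In particular, two distinct directions in ℝP² represented by integer vectors of norm at most N are at angular distance at least 1/N² from each other. -/

import Mathlib

/-- The real image in `ℝ³` of an integer vector `v ∈ ℤ³`, viewed in Euclidean space. -/
noncomputable def intCast3 (v : Fin 3 → ℤ) : EuclideanSpace ℝ (Fin 3) :=
  (WithLp.equiv 2 (Fin 3 → ℝ)).symm (fun i => (v i : ℝ))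

lemma sep_aux (x y : EuclideanSpace ℝ (Fin 3)) (hx : x ≠ 0) (hy : y ≠ 0)
    (h : inner ℝ x y ^ 2 + 1 ≤ ‖x‖ ^ 2 * ‖y‖ ^ 2) :
    1 / (‖x‖ * ‖y‖) ≤ ‖‖x‖⁻¹ • x - ‖y‖⁻¹ • y‖ := by
  have ha : 0 < ‖x‖ := norm_pos_iff.mpr hx
  have hb : 0 < ‖y‖ := norm_pos_iff.mpr hy
  have ht : 0 < ‖x‖ * ‖y‖ := mul_pos ha hb
  refine (sq_le_sq₀ (by positivity) (norm_nonneg _)).mp ?_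
  rw [norm_sub_sq_real, norm_smul, norm_smul, real_inner_smul_left, real_inner_smul_right,
    norm_inv, norm_inv, norm_norm, norm_norm, inv_mul_cancel₀ ha.ne', inv_mul_cancel₀ hb.ne',
    div_pow, div_le_iff₀ (by positivity)]
  have e : (1 ^ 2 - 2 * (‖x‖⁻¹ * (‖y‖⁻¹ * inner ℝ x y)) + 1 ^ 2) * (‖x‖ * ‖y‖) ^ 2
      = 2 * (‖x‖ * ‖y‖) ^ 2 - 2 * inner ℝ x y * (‖x‖ * ‖y‖) := by
    field_simp
    ring
  rw [e]
  nlinarith [sq_nonneg (‖x‖ * ‖y‖ - inner ℝ x y)]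

theorem projective_separation_of_int_directions (v w : Fin 3 → ℤ)
    (h : LinearIndependent ℝ ![intCast3 v, intCast3 w]) :
    1 / (‖intCast3 v‖ * ‖intCast3 w‖) ≤
      min ‖‖intCast3 v‖⁻¹ • intCast3 v - ‖intCast3 w‖⁻¹ • intCast3 w‖
          ‖‖intCast3 v‖⁻¹ • intCast3 v + ‖intCast3 w‖⁻¹ • intCast3 w‖ := by
  have hx : intCast3 v ≠ 0 := by simpa using h.ne_zero 0
  have hy : intCast3 w ≠ 0 := by simpa using h.ne_zero 1
  have hb : 0 < ‖intCast3 w‖ := norm_pos_iff.mpr hy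
  have hlt : inner ℝ (intCast3 v) (intCast3 w) ^ 2 < ‖intCast3 v‖ ^ 2 * ‖intCast3 w‖ ^ 2 := by
    by_contra hcon
    push Not at hcon
    rw [LinearIndependent.pair_iff] at h
    have h0 := h (‖intCast3 w‖ ^ 2) (-inner ℝ (intCast3 v) (intCast3 w)) (by
      rw [neg_smul, ← sub_eq_add_neg, ← norm_eq_zero, ← sq_eq_zero_iff]
      apply le_antisymm _ (sq_nonneg _)
      rw [norm_sub_sq_real, norm_smul, norm_smul, real_inner_smul_left, real_inner_smul_right,
        mul_pow, mul_pow, Real.norm_eq_abs, Real.norm_eq_abs, sq_abs, sq_abs]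
      nlinarith [mul_le_mul_of_nonneg_left hcon (sq_nonneg ‖intCast3 w‖)])
    exact (pow_pos hb 2).ne' h0.1
  have hI : inner ℝ (intCast3 v) (intCast3 w) ^ 2 + 1 ≤ ‖intCast3 v‖ ^ 2 * ‖intCast3 w‖ ^ 2 := by
    have e1 : inner ℝ (intCast3 v) (intCast3 w) = ((∑ i, v i * w i : ℤ) : ℝ) := by
      simp [intCast3, PiLp.inner_apply, mul_comm]
    have e2 : ∀ u, ‖intCast3 u‖ ^ 2 = ((∑ i, u i ^ 2 : ℤ) : ℝ) := by
      intro u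
      simp [intCast3, EuclideanSpace.norm_sq_eq]
    rw [e1, e2, e2] at hlt ⊢
    exact_mod_cast hlt
  refine le_min (sep_aux _ _ hx hy hI) ?_
  have := sep_aux (intCast3 v) (-intCast3 w) hx (neg_ne_zero.mpr hy) (by simpa using hI)
  simpa using this
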